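/- Let d be a positive integer and let ε : {0,…,d−1} → {−1,1} be any sign pattern. Then the set Π*_{d,ε} of coefficient vectors (a_0,…,a_{d−1}) ∈ ℝ^d such that the monic polynomial Q = x^d + a_{d−1}x^{d−1} + ⋯ + a_0 has d distinct real roots, all nonzero, and has sign pattern ε, is nonempty and contractible. In particular, for each sign pattern there is exactly one connected component of the set of monic degree-d polynomials with d distinct nonzero real roots and all coefficients nonzero whose polynomials have the signs of the coefficients given by ε. -/

import Mathlib

open Polynomial

/-- The monic polynomial `x^d + a_{d-1} x^{d-1} + ⋯ + a_1 x + a_0`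
associated to a coefficient vector `a ∈ ℝ^d`. -/
noncomputable def Qpoly (d : ℕ) (a : Fin d → ℝ) : Polynomial ℝ :=
  X ^ d + ∑ j : Fin d, C (a j) * X ^ (j : ℕ)

/-- `Qpoly d a` has `d` distinct real roots, all nonzero. -/
def DistinctNonzeroRealRoots (d : ℕ) (a : Fin d → ℝ) : Prop :=
  ∃ r : Fin d → ℝ, Function.Injective r ∧ (∀ i, r i ≠ 0) ∧
    Qpoly d a = ∏ i : Fin d, (X - C (r i))

section Multipliers

open Finset

/-- The polynomial `c 0 + c 1 * x + ⋯ + c d * x ^ d` has `d` distinct nonzero real roots. -/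
def HasSimpleRealRoots (d : ℕ) (c : ℕ → ℝ) : Prop :=
  ∃ r : Fin d → ℝ, Function.Injective r ∧ (∀ i, r i ≠ 0) ∧
    ∀ i, ∑ j ∈ range (d + 1), c j * r i ^ j = 0

theorem HasSimpleRealRoots.const_mul {d : ℕ} {c : ℕ → ℝ} (h : HasSimpleRealRoots d c) (k : ℝ) :
    HasSimpleRealRoots d (fun j => k * c j) := by
  obtain ⟨r, hr, hr0, hz⟩ := h
  refine ⟨r, hr, hr0, fun i => ?_⟩
  simp only [mul_assoc, ← mul_sum, hz, mul_zero]

theorem hasDerivAt_abs_rpow_of_ne_zero {c x : ℝ} (hx : x ≠ 0) :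
    HasDerivAt (fun y : ℝ => |y| ^ c) (|x| ^ c * (c / x)) x := by
  have key : ∀ y : ℝ, y ≠ 0 → |y| ^ c = Real.exp (Real.log y * c) := fun y hy => by
    rw [Real.rpow_def_of_pos (abs_pos.mpr hy), Real.log_abs]
  have h := ((Real.hasDerivAt_log hx).mul_const c).exp
  rw [← key x hx] at h
  have h' : HasDerivAt (fun y : ℝ => |y| ^ c) (|x| ^ c * (x⁻¹ * c)) x := by
    refine h.congr_of_eventuallyEq ?_
    filter_upwards [isOpen_ne.mem_nhds hx] with y hy using key y hy
  convert h' using 2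
  ring

theorem hasDerivAt_sum_mul_pow (n : ℕ) (c : ℕ → ℝ) (x : ℝ) :
    HasDerivAt (fun y : ℝ => ∑ j ∈ range n, c j * y ^ j)
      (∑ j ∈ range n, c j * (j * x ^ (j - 1))) x :=
  HasDerivAt.fun_sum fun j _ => (hasDerivAt_pow j x).const_mul (c j)

/-- Rolle's theorem for `|x| ^ (1 / s) * P x` on an interval avoiding the origin. -/
theorem exists_root_one_add_mul {n : ℕ} {c : ℕ → ℝ} {s : ℝ} (hs : 0 < s) {p q : ℝ} (hpq : p < q)
    (h0 : (0 : ℝ) ∉ Set.Ioo p q)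
    (hp : p = 0 ∨ ∑ j ∈ range n, c j * p ^ j = 0)
    (hq : q = 0 ∨ ∑ j ∈ range n, c j * q ^ j = 0) :
    ∃ y ∈ Set.Ioo p q, ∑ j ∈ range n, (1 + s * j) * c j * y ^ j = 0 := by
  have hs' : (1 / s) ≠ 0 := (one_div_pos.mpr hs).ne'
  have hz : ∀ z : ℝ, (z = 0 ∨ ∑ j ∈ range n, c j * z ^ j = 0) →
      |z| ^ (1 / s) * ∑ j ∈ range n, c j * z ^ j = 0 := by
    rintro z (rfl | h)
    · rw [abs_zero, Real.zero_rpow hs', zero_mul]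
    · rw [h, mul_zero]
  have hcont : Continuous (fun y : ℝ => |y| ^ (1 / s) * ∑ j ∈ range n, c j * y ^ j) := by
    refine Continuous.mul ?_ (by fun_prop)
    exact continuous_abs.rpow_const fun _ => Or.inr (one_div_pos.mpr hs).le
  obtain ⟨y, hy, hd⟩ := exists_hasDerivAt_eq_zero hpq hcont.continuousOn
    ((hz p hp).trans (hz q hq).symm) (fun y hy =>
      (hasDerivAt_abs_rpow_of_ne_zero (c := 1 / s) (x := y) (fun h => h0 (h ▸ hy))).mul
        (hasDerivAt_sum_mul_pow n c y))
  refine ⟨y, hy, ?_⟩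
  have hy0 : y ≠ 0 := fun h => h0 (h ▸ hy)
  have hpos : |y| ^ (1 / s) ≠ 0 := (Real.rpow_pos_of_pos (abs_pos.mpr hy0) _).ne'
  have hd' : |y| ^ (1 / s) * (1 / s / y * ∑ j ∈ range n, c j * y ^ j +
      ∑ j ∈ range n, c j * (j * y ^ (j - 1))) = 0 := by rw [← hd]; ring
  have hd2 := (mul_eq_zero.mp hd').resolve_left hpos
  have h3 : ∑ j ∈ range n, (1 + s * j) * c j * y ^ j = s * y * (1 / s / y *
      ∑ j ∈ range n, c j * y ^ j + ∑ j ∈ range n, c j * (j * y ^ (j - 1))) := by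
    rw [mul_add, ← mul_assoc, show s * y * (1 / s / y) = 1 by field_simp, one_mul, mul_sum,
      ← sum_add_distrib]
    refine sum_congr rfl fun j _ => ?_
    rcases j with _ | j
    · simp
    · simp only [Nat.add_sub_cancel]; ring
  rw [h3, hd2, mul_zero]

theorem HasSimpleRealRoots.one_add_mul {d : ℕ} {c : ℕ → ℝ} (h : HasSimpleRealRoots d c)
    {s : ℝ} (hs : 0 ≤ s) : HasSimpleRealRoots d (fun j => (1 + s * j) * c j) := by
  rcases hs.eq_or_lt with rfl | hs
  · simpa using h
  obtain ⟨r, hr, hr0, hz⟩ := h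
  have hnot : (0 : ℝ) ∉ univ.image r := by simpa using hr0
  have hcard : (insert 0 (univ.image r)).card = d + 1 := by
    rw [card_insert_of_notMem hnot, card_image_of_injective _ hr, card_univ, Fintype.card_fin]
  set z := (insert 0 (univ.image r)).orderEmbOfFin hcard with hzdef
  have hzmem : ∀ i, z i = 0 ∨ ∑ j ∈ range (d + 1), c j * z i ^ j = 0 := fun i => by
    have := orderEmbOfFin_mem (insert 0 (univ.image r)) hcard i
    rw [← hzdef] at this
    rcases mem_insert.mp this with h | h
    · exact Or.inl h
    · obtain ⟨k, -, hk⟩ := mem_image.mp h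
      exact Or.inr (hk ▸ hz k)
  obtain ⟨m, hm⟩ : ∃ m, z m = 0 := by
    have : (0 : ℝ) ∈ Set.range z := by
      rw [hzdef, range_orderEmbOfFin]; simp
    exact this
  have h0 : ∀ i : Fin d, (0 : ℝ) ∉ Set.Ioo (z i.castSucc) (z i.succ) := fun i hi => by
    rw [← hm, Set.mem_Ioo, z.lt_iff_lt, z.lt_iff_lt] at hi
    obtain ⟨h1, h2⟩ := hi
    simp only [Fin.lt_def, Fin.val_castSucc, Fin.val_succ] at h1 h2
    omega
  choose y hy hy0 using fun i : Fin d => exists_root_one_add_mul hs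
    (z.strictMono i.castSucc_lt_succ) (h0 i) (hzmem _) (hzmem _)
  refine ⟨y, StrictMono.injective fun i k hik => ?_, fun i h => h0 i (h ▸ hy i), hy0⟩
  refine (hy i).2.trans_le (le_trans (z.monotone ?_) (hy k).1.le)
  simp only [Fin.le_def, Fin.val_castSucc, Fin.val_succ]
  exact hik

theorem HasSimpleRealRoots.one_add_pow_mul {d : ℕ} {c : ℕ → ℝ} (h : HasSimpleRealRoots d c)
    (n : ℕ) : HasSimpleRealRoots d (fun j => (1 + (j : ℝ)) ^ n * c j) := by
  induction n with
  | zero => simpa using h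
  | succ n ih =>
    have := ih.one_add_mul zero_le_one
    simpa only [one_mul, pow_succ', mul_assoc] using this

/-- At a point where one term of a polynomial dominates, the polynomial has the sign of
that term. -/
theorem sum_mul_term_pos {d k : ℕ} (hk : k ≤ d) {c : ℕ → ℝ} {x : ℝ}
    (h : ∀ j ≤ d, j ≠ k → (d + 1) * |c j * x ^ j| < |c k * x ^ k|) (h0 : c k * x ^ k ≠ 0) :
    0 < (∑ j ∈ range (d + 1), c j * x ^ j) * (c k * x ^ k) := by
  have hmem : k ∈ range (d + 1) := mem_range.mpr (by omega)
  rw [← add_sum_erase _ _ hmem]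
  set R := ∑ j ∈ (range (d + 1)).erase k, c j * x ^ j
  set m := c k * x ^ k
  have hR : (d + 1) * |R| ≤ d * |m| := by
    calc (d + 1) * |R| ≤ (d + 1) * ∑ j ∈ (range (d + 1)).erase k, |c j * x ^ j| := by
          gcongr; exact abs_sum_le_sum_abs _ _
      _ = ∑ j ∈ (range (d + 1)).erase k, (d + 1) * |c j * x ^ j| := mul_sum _ _ _
      _ ≤ ∑ j ∈ (range (d + 1)).erase k, |m| := by
          refine sum_le_sum fun j hj => (h j ?_ (ne_of_mem_erase hj)).le
          have := mem_range.mp (mem_of_mem_erase hj)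
          omega
      _ = d * |m| := by
          rw [sum_const, card_erase_of_mem hmem, card_range, nsmul_eq_mul, Nat.add_sub_cancel]
  have hm : 0 < |m| := abs_pos.mpr h0
  have hlt : |R| < |m| := by
    by_contra! hcon
    have hd : (0 : ℝ) ≤ d := Nat.cast_nonneg d
    nlinarith [mul_le_mul_of_nonneg_left hcon hd]
  have h1 : |R * m| < m * m := by
    rw [abs_mul, ← abs_mul_abs_self m]
    exact mul_lt_mul_of_pos_right hlt hm
  have := neg_lt_of_abs_lt h1
  linarith [add_mul m R m]

theorem hasSimpleRealRoots_of_dominated {d : ℕ} {c : ℕ → ℝ} {ρ : ℕ → ℝ} (hρ : StrictMono ρ)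
    (hρ0 : ∀ k, 0 < ρ k) (hc : ∀ k ≤ d, c k ≠ 0)
    (h : ∀ k ≤ d, ∀ j ≤ d, j ≠ k → (d + 1) * (|c j| * ρ k ^ j) < |c k| * ρ k ^ k) :
    HasSimpleRealRoots d c := by
  have hsign : ∀ σ : ℝ, |σ| = 1 → ∀ k ≤ d,
      0 < (∑ j ∈ range (d + 1), c j * (σ * ρ k) ^ j) * (c k * σ ^ k) := by
    intro σ hσ k hk
    have habs : ∀ j, |c j * (σ * ρ k) ^ j| = |c j| * ρ k ^ j := fun j => by
      rw [abs_mul, abs_pow, abs_mul, hσ, one_mul, abs_of_pos (hρ0 k)]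
    have hσ0 : σ ≠ 0 := fun h => by simp [h] at hσ
    have := sum_mul_term_pos hk (c := c) (x := σ * ρ k)
      (fun j hj hjk => by rw [habs, habs]; exact h k hk j hj hjk)
      (mul_ne_zero (hc k hk) (pow_ne_zero _ (mul_ne_zero hσ0 (hρ0 k).ne')))
    rw [mul_pow σ, ← mul_assoc (c k), ← mul_assoc] at this
    exact pos_of_mul_pos_left this (pow_pos (hρ0 k) k).le
  have hex : ∀ i : Fin d, ∃ y : ℝ, ρ i < |y| ∧ |y| < ρ (i + 1) ∧
      ∑ j ∈ range (d + 1), c j * y ^ j = 0 := by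
    intro i
    obtain ⟨σ, hσ, hσc⟩ : ∃ σ : ℝ, |σ| = 1 ∧ σ * (c i * c (i + 1)) < 0 := by
      rcases (mul_ne_zero (hc i i.2.le) (hc (i + 1) i.2)).lt_or_gt with h | h
      · exact ⟨1, by simp, by linarith⟩
      · exact ⟨-1, by simp, by linarith⟩
    have h1 := hsign σ hσ i i.2.le
    have h2 := hsign σ hσ (i + 1) i.2
    set f : ℝ → ℝ := fun x => ∑ j ∈ range (d + 1), c j * (σ * x) ^ j with hf
    change 0 < f (ρ i) * _ at h1
    change 0 < f (ρ (i + 1)) * _ at h2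
    have hfc : Continuous f := by fun_prop
    have hprod : f (ρ i) * f (ρ (i + 1)) < 0 := by
      have h3 := mul_pos h1 h2
      have h4 : f (ρ i) * (c i * σ ^ (i : ℕ)) * (f (ρ (i + 1)) * (c (i + 1) * σ ^ ((i : ℕ) + 1))) =
        (f (ρ i) * f (ρ (i + 1))) * (σ * (c i * c (i + 1))) * (σ ^ (i : ℕ)) ^ 2 := by ring
      rw [h4] at h3
      have h5 := pos_of_mul_pos_left h3 (sq_nonneg _)
      by_contra! hcon
      exact absurd h5 (not_lt.mpr (mul_nonpos_of_nonneg_of_nonpos hcon hσc.le))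
    have hlt : ρ i < ρ (i + 1) := hρ (Nat.lt_succ_self _)
    obtain ⟨x, hx, hx0⟩ : ∃ x ∈ Set.Ioo (ρ i) (ρ (i + 1)), f x = 0 := by
      rcases mul_neg_iff.mp hprod with ⟨ha, hb⟩ | ⟨ha, hb⟩
      · exact intermediate_value_Ioo' hlt.le hfc.continuousOn ⟨hb, ha⟩
      · exact intermediate_value_Ioo hlt.le hfc.continuousOn ⟨ha, hb⟩
    have hax : |σ * x| = x := by rw [abs_mul, hσ, one_mul, abs_of_pos ((hρ0 i).trans hx.1)]
    exact ⟨σ * x, hx.1.trans_eq hax.symm, hax.trans_lt hx.2, hx0⟩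
  choose y hy1 hy2 hy0 using hex
  have hmono : StrictMono fun i => |y i| := fun i k hik =>
    (hy2 i).trans_le ((hρ.monotone (Nat.succ_le_of_lt hik)).trans (hy1 k).le)
  exact ⟨y, fun i k hik => hmono.injective (congrArg abs hik),
    fun i => abs_pos.mp ((hρ0 i).trans (hy1 i)), hy0⟩

/-- A continuous family of multiplier sequences interpolating the powers `(1 + j) ^ n`. -/
noncomputable def powerMultiplier (t : ℝ) (j : ℕ) : ℝ :=
  (1 + (j : ℝ)) ^ t * ((1 + Int.fract t * j) * (1 + (j : ℝ)) ^ (-Int.fract t))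

theorem one_add_natCast_pos (j : ℕ) : (0 : ℝ) < 1 + j := by positivity

theorem powerMultiplier_eq {t : ℝ} (ht : 0 ≤ t) (j : ℕ) :
    powerMultiplier t j = (1 + Int.fract t * j) * (1 + (j : ℝ)) ^ ⌊t⌋₊ := by
  have h : t + -Int.fract t = (⌊t⌋₊ : ℝ) := by
    rw [← sub_eq_add_neg, Int.self_sub_fract, natCast_floor_eq_intCast_floor ht]
  rw [powerMultiplier, mul_left_comm, ← Real.rpow_add (one_add_natCast_pos j), h,
    Real.rpow_natCast]

theorem powerMultiplier_pos (t : ℝ) (j : ℕ) : 0 < powerMultiplier t j := by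
  have h := one_add_natCast_pos j
  have := Int.fract_nonneg t
  unfold powerMultiplier
  positivity

theorem powerMultiplier_zero (j : ℕ) : powerMultiplier 0 j = 1 := by
  simp [powerMultiplier]

theorem continuous_powerMultiplier (j : ℕ) : Continuous fun t => powerMultiplier t j := by
  have h := one_add_natCast_pos j
  refine (continuous_const.rpow continuous_id fun _ => Or.inl h.ne').mul ?_
  have hc : Continuous fun x : ℝ => (1 + x * j) * (1 + (j : ℝ)) ^ (-x) :=
    (by fun_prop : Continuous fun x : ℝ => 1 + x * (j : ℝ)).mul
      (continuous_const.rpow continuous_neg fun _ => Or.inl h.ne')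
  refine ContinuousOn.comp_fract'' hc.continuousOn ?_
  simp [Real.rpow_neg_one, h.ne']

theorem rpow_le_powerMultiplier (t : ℝ) (j : ℕ) : (1 + (j : ℝ)) ^ t ≤ powerMultiplier t j := by
  have h := one_add_natCast_pos j
  refine le_mul_of_one_le_right (Real.rpow_nonneg h.le t) ?_
  rw [Real.rpow_neg h.le, ← div_eq_mul_inv, one_le_div (Real.rpow_pos_of_pos h _)]
  exact rpow_one_add_le_one_add_mul_self
    (by have : (0 : ℝ) ≤ j := Nat.cast_nonneg j
        linarith) (Int.fract_nonneg t) (Int.fract_lt_one t).le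

theorem powerMultiplier_le (t : ℝ) {d j : ℕ} (hj : j ≤ d) :
    powerMultiplier t j ≤ (d + 1) * (1 + (j : ℝ)) ^ t := by
  have h := one_add_natCast_pos j
  have hj' : (j : ℝ) ≤ d := Nat.cast_le.mpr hj
  have hj0 : (0 : ℝ) ≤ j := Nat.cast_nonneg j
  have h1 : 1 + Int.fract t * j ≤ d + 1 := by
    nlinarith [Int.fract_lt_one t]
  have h2 : (1 + (j : ℝ)) ^ (-Int.fract t) ≤ 1 :=
    Real.rpow_le_one_of_one_le_of_nonpos (by linarith) (neg_nonpos.mpr (Int.fract_nonneg t))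
  rw [powerMultiplier, mul_comm]
  refine mul_le_mul_of_nonneg_right ?_ (Real.rpow_nonneg h.le t)
  calc _ ≤ (d + 1 : ℝ) * 1 :=
        mul_le_mul h1 h2 (Real.rpow_nonneg h.le _) (by positivity)
    _ = d + 1 := mul_one _

theorem HasSimpleRealRoots.powerMultiplier_mul {d : ℕ} {c : ℕ → ℝ} (h : HasSimpleRealRoots d c)
    {t : ℝ} (ht : 0 ≤ t) : HasSimpleRealRoots d (fun j => powerMultiplier t j * c j) := by
  have := (h.one_add_pow_mul ⌊t⌋₊).one_add_mul (Int.fract_nonneg t)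
  simpa only [powerMultiplier_eq ht, mul_assoc] using this

/-- Strict concavity of the logarithm, uniformly over finitely many integer points. -/
theorem exists_log_tangent_gap (d : ℕ) : ∃ δ : ℝ, 0 < δ ∧ ∀ k ≤ d, ∀ j ≤ d, j ≠ k →
    δ ≤ Real.log (1 + k) - Real.log (1 + j) + ((j : ℝ) - k) / (1 + k) := by
  set φ : ℕ × ℕ → ℝ := fun p =>
    Real.log (1 + p.1) - Real.log (1 + p.2) + ((p.2 : ℝ) - p.1) / (1 + p.1) with hφ
  have hpos : ∀ k j : ℕ, j ≠ k → 0 < φ (k, j) := by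
    intro k j hjk
    have hk := one_add_natCast_pos k
    have hj := one_add_natCast_pos j
    have h := Real.log_lt_sub_one_of_pos (div_pos hj hk) (fun h => hjk (by
      rw [div_eq_one_iff_eq hk.ne'] at h
      exact_mod_cast add_left_cancel h))
    rw [Real.log_div hj.ne' hk.ne'] at h
    have h2 : ((j : ℝ) - k) / (1 + k) = (1 + j) / (1 + k) - 1 := by field_simp; ring
    simp only [hφ]
    linarith
  rcases (range (d + 1)).offDiag.eq_empty_or_nonempty with he | hne
  · refine ⟨1, one_pos, fun k hk j hj hjk => ?_⟩
    have : (k, j) ∈ (range (d + 1)).offDiag := by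
      simp only [mem_offDiag, mem_range]; omega
    simp [he] at this
  · obtain ⟨p, hp, hmin⟩ := exists_min_image _ φ hne
    refine ⟨φ p, hpos _ _ (mem_offDiag.mp hp).2.2.symm, fun k hk j hj hjk => ?_⟩
    refine hmin (k, j) ?_
    simp only [mem_offDiag, mem_range]; omega

theorem hasSimpleRealRoots_powerMultiplier_mul {d : ℕ} {δ U t : ℝ} {c : ℕ → ℝ} (hδ : 0 < δ)
    (hgap : ∀ k ≤ d, ∀ j ≤ d, j ≠ k →
      δ ≤ Real.log (1 + k) - Real.log (1 + j) + ((j : ℝ) - k) / (1 + k))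
    (hc : ∀ j ≤ d, c j ≠ 0) (hU : ∀ j ≤ d, |Real.log (c j)| ≤ U) (hU0 : 0 ≤ U)
    (ht : (2 * Real.log (d + 1) + 2 * U + 1) / δ ≤ t) :
    HasSimpleRealRoots d (fun j => powerMultiplier t j * c j) := by
  have hd1 : (0 : ℝ) < d + 1 := by positivity
  have hlog : 0 ≤ Real.log (d + 1) := Real.log_nonneg (by
    have : (0 : ℝ) ≤ d := Nat.cast_nonneg d
    linarith)
  have ht0 : 0 < t := lt_of_lt_of_le (by positivity) ht
  rw [div_le_iff₀ hδ] at ht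
  refine hasSimpleRealRoots_of_dominated (ρ := fun k => Real.exp (-(t / (1 + k)))) ?_
    (fun k => Real.exp_pos _)
    (fun k hk => mul_ne_zero (powerMultiplier_pos t k).ne' (hc k hk)) ?_
  · intro i k hik
    refine Real.exp_lt_exp.mpr (neg_lt_neg ?_)
    have := one_add_natCast_pos i
    have : (i : ℝ) < k := Nat.cast_lt.mpr hik
    gcongr
  intro k hk j hj hjk
  have hexp : ∀ i : ℕ, Real.exp (-(t / (1 + k))) ^ i = Real.exp (-(t * (i / (1 + k)))) :=
    fun i => by rw [← Real.exp_nat_mul]; congr 1; ring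
  have hcexp : ∀ i ≤ d, |c i| = Real.exp (Real.log (c i)) := fun i hi =>
    (Real.exp_log_eq_abs (hc i hi)).symm
  have hpow : ∀ i : ℕ, (1 + (i : ℝ)) ^ t = Real.exp (t * Real.log (1 + i)) := fun i => by
    rw [Real.rpow_def_of_pos (one_add_natCast_pos i), mul_comm]
  have habs : ∀ i : ℕ, |powerMultiplier t i * c i| = powerMultiplier t i * |c i| := fun i => by
    rw [abs_mul, abs_of_pos (powerMultiplier_pos t i)]
  have hUj := (abs_le.mp (hU j hj)).2
  have hUk := (abs_le.mp (hU k hk)).1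
  simp only [habs, hexp]
  calc (d + 1 : ℝ) * (powerMultiplier t j * |c j| * Real.exp (-(t * (j / (1 + k)))))
      ≤ (d + 1 : ℝ) * ((d + 1) * Real.exp (t * Real.log (1 + j)) * Real.exp U *
          Real.exp (-(t * (j / (1 + k))))) := by
        have h1 := powerMultiplier_le t hj
        have h2 : |c j| ≤ Real.exp U := by rw [hcexp j hj]; exact Real.exp_le_exp.mpr hUj
        rw [hpow] at h1
        gcongr
    _ = Real.exp (2 * Real.log (d + 1) + t * Real.log (1 + j) + U - t * (j / (1 + k))) := by
        rw [show 2 * Real.log (d + 1) + t * Real.log (1 + j) + U - t * (j / (1 + k)) =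
          Real.log (d + 1) + (Real.log (d + 1) + t * Real.log (1 + j) + U +
            -(t * (j / (1 + k)))) by ring]
        simp only [Real.exp_add, Real.exp_log hd1]
    _ < Real.exp (t * Real.log (1 + k) + -U + -(t * (k / (1 + k)))) := by
        refine Real.exp_lt_exp.mpr ?_
        have h1 := mul_le_mul_of_nonneg_left (hgap k hk j hj hjk) ht0.le
        rw [sub_div] at h1
        linarith
    _ ≤ powerMultiplier t k * |c k| * Real.exp (-(t * (k / (1 + k)))) := by
        rw [Real.exp_add, Real.exp_add]
        have h1 := rpow_le_powerMultiplier t k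
        have h2 : Real.exp (-U) ≤ |c k| := by rw [hcexp k hk]; exact Real.exp_le_exp.mpr hUk
        rw [hpow] at h1
        have := (powerMultiplier_pos t k).le
        gcongr

/-- The coefficients of the monic polynomial with lower coefficients `a`. -/
def monicCoeff {d : ℕ} (a : Fin d → ℝ) (j : ℕ) : ℝ := if h : j < d then a ⟨j, h⟩ else 1

theorem eval_Qpoly (d : ℕ) (a : Fin d → ℝ) (x : ℝ) :
    (Qpoly d a).eval x = ∑ j ∈ range (d + 1), monicCoeff a j * x ^ j := by
  rw [sum_range_succ, ← Fin.sum_univ_eq_sum_range (fun j => monicCoeff a j * x ^ j)]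
  simp [Qpoly, monicCoeff, eval_finsetSum, add_comm]

theorem distinctNonzeroRealRoots_iff (d : ℕ) (a : Fin d → ℝ) :
    DistinctNonzeroRealRoots d a ↔ HasSimpleRealRoots d (monicCoeff a) := by
  refine exists_congr fun r => and_congr_right fun hr => and_congr_right fun _ => ?_
  simp only [← eval_Qpoly]
  constructor
  · intro h i
    rw [h, eval_prod]
    exact prod_eq_zero (mem_univ i) (by simp)
  · intro h
    have hlow : (∑ j : Fin d, C (a j) * X ^ (j : ℕ)).degree < ((X : ℝ[X]) ^ d).degree := by
      rw [degree_X_pow]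
      refine (degree_sum_le _ _).trans_lt ((Finset.sup_lt_iff (WithBot.bot_lt_coe d)).mpr ?_)
      exact fun j _ => (degree_C_mul_X_pow_le _ _).trans_lt (Nat.cast_lt.mpr j.2)
    have hmonic : (Qpoly d a).Monic := (monic_X_pow d).add_of_left hlow
    have hdeg : (Qpoly d a).degree = d := by
      rw [Qpoly, degree_add_eq_left_of_degree_lt hlow, degree_X_pow]
    have hmonic' : (∏ i : Fin d, (X - C (r i))).Monic := monic_prod_of_monic _ _ fun i _ =>
      monic_X_sub_C (r i)
    have hdeg' : (∏ i : Fin d, (X - C (r i))).degree = (d : WithBot ℕ) := by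
      simp [degree_prod]
    refine Polynomial.eq_of_degree_le_of_eval_index_eq univ (v := r) hr.injOn (by simp [hdeg])
      (by rw [hdeg, hdeg']) (by rw [hmonic.leadingCoeff, hmonic'.leadingCoeff]) fun i _ => ?_
    rw [h, eval_prod]
    exact (prod_eq_zero (mem_univ i) (by simp)).symm

theorem HasSimpleRealRoots.congr {d : ℕ} {c c' : ℕ → ℝ} (h : HasSimpleRealRoots d c)
    (hcc' : ∀ j ≤ d, c' j = c j) : HasSimpleRealRoots d c' := by
  obtain ⟨r, hr, hr0, hz⟩ := h
  refine ⟨r, hr, hr0, fun i => ?_⟩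
  rw [← hz i]
  refine sum_congr rfl fun j hj => ?_
  rw [hcc' j (by have := mem_range.mp hj; omega)]

/-- Coefficient vectors with sign pattern `ε` whose polynomial has `d` distinct nonzero
real roots. -/
def signedHyperbolic {d : ℕ} (ε : Fin d → ℝ) : Set (Fin d → ℝ) :=
  {a | (∀ j, 0 < ε j * a j) ∧ DistinctNonzeroRealRoots d a}

/-- The coefficients with logarithmic moduli `u` and signs `ε`, after applying the multiplier at
time `t` and normalizing the leading coefficient. -/
noncomputable def multiplierFlow {d : ℕ} (ε u : Fin d → ℝ) (t : ℝ) (j : Fin d) : ℝ :=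
  ε j * Real.exp (u j) * (powerMultiplier t j / powerMultiplier t d)

section Flow

variable {d : ℕ} {ε : Fin d → ℝ}

theorem continuous_multiplierFlow (ε : Fin d → ℝ) :
    Continuous fun p : (Fin d → ℝ) × ℝ => multiplierFlow ε p.1 p.2 := by
  refine continuous_pi fun j => ?_
  have h1 := (continuous_powerMultiplier j).comp (continuous_snd (X := Fin d → ℝ) (Y := ℝ))
  have h2 := (continuous_powerMultiplier d).comp (continuous_snd (X := Fin d → ℝ) (Y := ℝ))
  have h3 : Continuous fun p : (Fin d → ℝ) × ℝ => ε j * Real.exp (p.1 j) := by fun_prop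
  exact h3.mul (h1.div h2 fun p => (powerMultiplier_pos _ d).ne')

theorem multiplierFlow_mem (hε : ∀ j, ε j = 1 ∨ ε j = -1) {u : Fin d → ℝ} {t : ℝ}
    (h : HasSimpleRealRoots d
      (fun j => powerMultiplier t j * monicCoeff (fun j => ε j * Real.exp (u j)) j)) :
    multiplierFlow ε u t ∈ signedHyperbolic ε := by
  refine ⟨fun j => ?_, (distinctNonzeroRealRoots_iff d _).mpr
    ((h.const_mul (powerMultiplier t d)⁻¹).congr fun j hj => ?_)⟩
  · have h1 : ε j * ε j = 1 := by rcases hε j with h | h <;> simp [h]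
    rw [multiplierFlow, mul_assoc, ← mul_assoc (ε j), h1, one_mul]
    exact mul_pos (Real.exp_pos _) (div_pos (powerMultiplier_pos _ _) (powerMultiplier_pos _ _))
  · have hd := (powerMultiplier_pos t d).ne'
    by_cases hjd : j < d
    · simp only [monicCoeff, hjd, dif_pos, multiplierFlow]
      ring
    · obtain rfl : j = d := by omega
      simp [monicCoeff, hd]

/-- The logarithms of the moduli of the coefficients. -/
noncomputable def logModuli (a : Fin d → ℝ) (j : Fin d) : ℝ := Real.log (a j)

theorem sign_mul_exp_logModuli (hε : ∀ j, ε j = 1 ∨ ε j = -1) {a : Fin d → ℝ}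
    (ha : a ∈ signedHyperbolic ε) (j : Fin d) : ε j * Real.exp (logModuli a j) = a j := by
  have h0 := ha.1 j
  have hne : a j ≠ 0 := fun h => by simp [h] at h0
  rw [logModuli, Real.exp_log_eq_abs hne]
  rcases hε j with h | h <;> rw [h] at h0 ⊢
  · rw [abs_of_pos (by linarith)]; ring
  · rw [abs_of_neg (by linarith)]; ring

theorem multiplierFlow_logModuli_mem (hε : ∀ j, ε j = 1 ∨ ε j = -1) {a : Fin d → ℝ}
    (ha : a ∈ signedHyperbolic ε) {t : ℝ} (ht : 0 ≤ t) :
    multiplierFlow ε (logModuli a) t ∈ signedHyperbolic ε := by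
  refine multiplierFlow_mem hε ?_
  simp only [sign_mul_exp_logModuli hε ha]
  exact ((distinctNonzeroRealRoots_iff d a).mp ha.2).powerMultiplier_mul ht

theorem multiplierFlow_logModuli_zero (hε : ∀ j, ε j = 1 ∨ ε j = -1) {a : Fin d → ℝ}
    (ha : a ∈ signedHyperbolic ε) : multiplierFlow ε (logModuli a) 0 = a := by
  funext j
  simp [multiplierFlow, sign_mul_exp_logModuli hε ha, powerMultiplier_zero]

/-- After a time depending continuously on `u`, the flow has entered the set of polynomials with
`d` distinct nonzero real roots. -/
theorem exists_entrance_time (hε : ∀ j, ε j = 1 ∨ ε j = -1) :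
    ∃ τ : (Fin d → ℝ) → ℝ, Continuous τ ∧ (∀ u, 0 ≤ τ u) ∧
      ∀ u, multiplierFlow ε u (τ u) ∈ signedHyperbolic ε := by
  obtain ⟨δ, hδ, hgap⟩ := exists_log_tangent_gap d
  have hlog : 0 ≤ Real.log (d + 1) := Real.log_nonneg (by
    have : (0 : ℝ) ≤ d := Nat.cast_nonneg d
    linarith)
  have hU : ∀ u : Fin d → ℝ, 0 ≤ ∑ j, |u j| := fun u => sum_nonneg fun j _ => abs_nonneg _
  refine ⟨fun u => (2 * Real.log (d + 1) + 2 * ∑ j, |u j| + 1) / δ, by fun_prop,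
    fun u => ?_, fun u => multiplierFlow_mem hε
      (hasSimpleRealRoots_powerMultiplier_mul hδ hgap ?_ ?_ (hU u) le_rfl)⟩
  · have := hU u
    positivity
  · intro j hj
    unfold monicCoeff
    split_ifs with h
    · refine mul_ne_zero ?_ (Real.exp_pos _).ne'
      rcases hε ⟨j, h⟩ with h | h <;> simp [h]
    · exact one_ne_zero
  · intro j hj
    unfold monicCoeff
    split_ifs with h
    · have h1 : Real.log (ε ⟨j, h⟩ * Real.exp (u ⟨j, h⟩)) = u ⟨j, h⟩ := by
        rcases hε ⟨j, h⟩ with h | h <;> simp [h]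
      rw [h1]
      exact single_le_sum (f := fun j => |u j|) (fun i _ => abs_nonneg _) (mem_univ _)
    · simpa using hU u

theorem contractibleSpace_signedHyperbolic (hε : ∀ j, ε j = 1 ∨ ε j = -1) :
    ContractibleSpace (signedHyperbolic ε) := by
  obtain ⟨τ, hτ, hτ0, hmem⟩ := exists_entrance_time hε
  have hlog : Continuous fun a : signedHyperbolic ε => logModuli a.1 := by
    refine continuous_pi fun j => ?_
    refine Continuous.log ((continuous_apply j).comp continuous_subtype_val) fun a h => ?_
    have := a.2.1 j
    simp [h] at this
  have hflow := continuous_multiplierFlow ε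
  let K : C(signedHyperbolic ε, signedHyperbolic ε) :=
    ⟨fun a => ⟨multiplierFlow ε (logModuli a.1) (τ (logModuli a.1)), hmem _⟩,
      (hflow.comp (hlog.prodMk (hτ.comp hlog))).subtype_mk _⟩
  have hI : Continuous fun p : unitInterval × signedHyperbolic ε => (p.1 : ℝ) := by fun_prop
  have hL := hlog.comp (continuous_snd (X := unitInterval) (Y := signedHyperbolic ε))
  have h1 : (ContinuousMap.id (signedHyperbolic ε)).Homotopic K :=
    ⟨{ toFun := fun p => ⟨multiplierFlow ε (logModuli p.2.1) (p.1 * τ (logModuli p.2.1)),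
          multiplierFlow_logModuli_mem hε p.2.2 (mul_nonneg p.1.2.1 (hτ0 _))⟩
       continuous_toFun := (hflow.comp (hL.prodMk (hI.mul (hτ.comp hL)))).subtype_mk _
       map_zero_left := fun a => Subtype.ext (by
         simpa using multiplierFlow_logModuli_zero hε a.2)
       map_one_left := fun a => Subtype.ext (by simp [K]) }⟩
  have hv : Continuous fun p : unitInterval × signedHyperbolic ε =>
      (1 - (p.1 : ℝ)) • logModuli p.2.1 := (continuous_const.sub hI).smul hL
  have h2 : K.Homotopic (ContinuousMap.const _ ⟨multiplierFlow ε 0 (τ 0), hmem 0⟩) :=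
    ⟨{ toFun := fun p => ⟨multiplierFlow ε ((1 - (p.1 : ℝ)) • logModuli p.2.1)
          (τ ((1 - (p.1 : ℝ)) • logModuli p.2.1)), hmem _⟩
       continuous_toFun := (hflow.comp (hv.prodMk (hτ.comp hv))).subtype_mk _
       map_zero_left := fun a => Subtype.ext (by simp [K])
       map_one_left := fun a => Subtype.ext (by simp) }⟩
  exact (contractible_iff_id_nullhomotopic _).mpr ⟨_, h1.trans h2⟩

theorem nonempty_signedHyperbolic (hε : ∀ j, ε j = 1 ∨ ε j = -1) :
    (signedHyperbolic ε).Nonempty := by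
  obtain ⟨τ, -, -, hmem⟩ := exists_entrance_time hε
  exact ⟨_, hmem 0⟩

/-- Connected sets of vectors with nonzero coordinates have constant sign pattern. -/
theorem sign_mul_pos_of_isPreconnected {C : Set (Fin d → ℝ)} (hC : IsPreconnected C)
    {j : Fin d} (h0 : ∀ a ∈ C, a j ≠ 0) (hε : ε j ≠ 0) {a b : Fin d → ℝ} (ha : a ∈ C) (hb : b ∈ C)
    (hpos : 0 < ε j * a j) : 0 < ε j * b j := by
  by_contra! hle
  have hcont : Continuous fun x : Fin d → ℝ => ε j * x j := by fun_prop
  obtain ⟨x, hx, hx0⟩ := hC.intermediate_value hb ha hcont.continuousOn ⟨hle, hpos.le⟩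
  exact (mul_ne_zero hε (h0 x hx)) hx0

end Flow

end Multipliers

theorem stmt4 (d : ℕ) (hd : 0 < d)
    (ε : Fin d → ℝ) (hε : ∀ j, ε j = 1 ∨ ε j = -1) :
    -- `Pd` is the set `Π*_d`: all coefficients nonzero, `d` distinct nonzero real roots
    let Pd : Set (Fin d → ℝ) := {a | (∀ j, a j ≠ 0) ∧ DistinctNonzeroRealRoots d a}
    -- `S` is the subset of `Π*_d` with sign pattern `ε`
    let S : Set (Fin d → ℝ) := {a | (∀ j : Fin d, 0 < ε j * a j) ∧ DistinctNonzeroRealRoots d a}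
    S.Nonempty ∧ ContractibleSpace S ∧
      -- `S` is exactly one connected component of `Π*_d`
      ∀ a ∈ S, connectedComponentIn Pd a = S := by
  intro Pd S
  have hcontr : ContractibleSpace S := contractibleSpace_signedHyperbolic hε
  refine ⟨nonempty_signedHyperbolic hε, hcontr, fun a ha => ?_⟩
  have hSP : S ⊆ Pd := fun b hb => ⟨fun j => right_ne_zero_of_mul (hb.1 j).ne', hb.2⟩
  have hconn : IsPreconnected S := isPreconnected_iff_preconnectedSpace.mpr inferInstance
  refine Set.Subset.antisymm (fun b hb => ⟨fun j => ?_, ?_⟩)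
    (hconn.subset_connectedComponentIn ha hSP)
  · refine sign_mul_pos_of_isPreconnected isPreconnected_connectedComponentIn
      (fun x hx => (connectedComponentIn_subset Pd a hx).1 j) ?_
      (mem_connectedComponentIn (hSP ha)) hb (ha.1 j)
    rcases hε j with h | h <;> simp [h]
  · exact (connectedComponentIn_subset Pd a hb).2
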